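/- Let V be an n-dimensional vector space over F_q, let s = 2d with d ≥ 2 and s < n, and let F ⊆ L(V) be an s-union antichain not contained in [V choose d]. Then |F| ≤ [n choose d]_q − q·[n−d choose 1]_q, and equality holds if and only if F = ([V choose d] \ {F : U ≤ F}) ∪ {U} for some fixed (d−1)-dimensional subspace U of V. -/

import Mathlib

open Module Set

/-- The Gaussian (q-)binomial coefficient, via the standard Pascal-type recurrence. -/
def gbinom (q : ℕ) : ℕ → ℕ → ℕ
  | _, 0 => 1
  | 0, _ + 1 => 0
  | n + 1, k + 1 => gbinom q n k + q ^ (k + 1) * gbinom q n (k + 1)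

set_option linter.unusedSectionVars false

section Counting

lemma gb_zero (q n : ℕ) : gbinom q n 0 = 1 := by cases n <;> rfl

lemma gb_succ (q n k : ℕ) :
    gbinom q (n + 1) (k + 1) = gbinom q n k + q ^ (k + 1) * gbinom q n (k + 1) := rfl

lemma gb_gt (q n k : ℕ) (h : n < k) : gbinom q n k = 0 := by
  induction n generalizing k with
  | zero => obtain ⟨k, rfl⟩ := Nat.exists_eq_succ_of_ne_zero h.ne'; rfl
  | succ n ih =>
    obtain ⟨k, rfl⟩ := Nat.exists_eq_succ_of_ne_zero (Nat.ne_of_gt (by omega : 0 < k))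
    rw [gb_succ, ih k (by omega), ih (k+1) (by omega)]; simp

lemma gb_self (q n : ℕ) : gbinom q n n = 1 := by
  induction n with
  | zero => rfl
  | succ n ih => rw [gb_succ, ih, gb_gt q n (n+1) (by omega)]; simp

lemma gb_one_succ (q n : ℕ) : gbinom q (n + 1) 1 = 1 + q * gbinom q n 1 := by
  rw [gb_succ, gb_zero]; simp

lemma gb_one_lt (q n : ℕ) (hq : 2 ≤ q) : gbinom q n 1 < q ^ n := by
  induction n with
  | zero => simp [gb_gt q 0 1]
  | succ n ih => rw [gb_one_succ, pow_succ]; nlinarith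

lemma gb_one_ge (q n : ℕ) : q ^ n ≤ gbinom q (n + 1) 1 := by
  induction n with
  | zero => simp [gb_self]
  | succ n ih => rw [gb_one_succ, pow_succ]; nlinarith

lemma gb_co_lt (q n : ℕ) (hq : 2 ≤ q) : gbinom q (n + 1) n < q ^ (n + 1) := by
  induction n with
  | zero => rw [gb_zero]; rw [zero_add, pow_one]; omega
  | succ n ih =>
    rw [gb_succ, gb_self, pow_succ q (n+1)]
    nlinarith [Nat.pow_pos (n := n+1) (by omega : 0 < q)]

def PP (q n k : ℕ) : ℤ := ∏ i ∈ Finset.range k, ((q : ℤ) ^ n - (q : ℤ) ^ i)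

lemma PP_succ (q n k : ℕ) : PP q n (k+1) = PP q n k * ((q : ℤ) ^ n - (q : ℤ) ^ k) := by
  simp [PP, Finset.prod_range_succ]

lemma PP_succ' (q n k : ℕ) :
    PP q (n+1) (k+1) = ((q : ℤ) ^ (n+1) - 1) * (q : ℤ) ^ k * PP q n k := by
  have : ∀ i ∈ Finset.range k, ((q:ℤ)^(n+1) - (q:ℤ)^(i+1)) = q * ((q:ℤ)^n - (q:ℤ)^i) := by
    intro i _; ring
  rw [PP, Finset.prod_range_succ', Finset.prod_congr rfl this, Finset.prod_mul_distrib, PP]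
  simp; ring

lemma gb_mul (q n k : ℕ) : (gbinom q n k : ℤ) * PP q k k = PP q n k := by
  induction n generalizing k with
  | zero =>
    cases k with
    | zero => simp [gb_zero, PP]
    | succ k =>
      rw [gb_gt q 0 (k+1) (by omega)]
      simp [PP, Finset.prod_range_succ']
  | succ n ih =>
    cases k with
    | zero => simp [gb_zero, PP]
    | succ k =>
      rw [gb_succ]
      push_cast
      rw [add_mul, mul_assoc, ih (k+1), PP_succ' q k k, PP_succ q n k, PP_succ' q n k, ← ih k]
      ring

lemma PP_pos (q n k : ℕ) (hq : 2 ≤ q) (h : k ≤ n) : 0 < PP q n k := by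
  apply Finset.prod_pos
  intro i hi
  rw [Finset.mem_range] at hi
  have : q ^ i < q ^ n := Nat.pow_lt_pow_right (by omega) (by omega)
  have : (q:ℤ) ^ i < (q:ℤ) ^ n := by exact_mod_cast this
  linarith

lemma PP_nat (q n k : ℕ) (hq : 2 ≤ q) (h : k ≤ n) :
    ((∏ i : Fin k, (q ^ n - q ^ (i:ℕ)) : ℕ) : ℤ) = PP q n k := by
  rw [Fin.prod_univ_eq_prod_range (fun i => q ^ n - q ^ i) k, PP]
  push_cast
  apply Finset.prod_congr rfl
  intro i hi
  rw [Finset.mem_range] at hi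
  rw [Nat.cast_sub (Nat.pow_le_pow_right (by omega) (by omega))]
  push_cast; rfl

variable {K : Type*} [Field K] [Fintype K] {V : Type*} [AddCommGroup V] [Module K V]
  [FiniteDimensional K V]

lemma card_sub (k : ℕ) :
    Nat.card {A : Submodule K V // finrank K A = k} = gbinom (Fintype.card K) (finrank K V) k := by
  have hfin : Finite V := Module.finite_of_finite K
  have hq : 2 ≤ Fintype.card K := Fintype.one_lt_card
  rcases lt_or_ge (finrank K V) k with h | h
  · rw [gb_gt _ _ _ h]
    have : IsEmpty {A : Submodule K V // finrank K A = k} :=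
      ⟨fun A => by have := A.1.finrank_le; have := A.2; omega⟩
    simp
  · let f : {s : Fin k → V // LinearIndependent K s} → {A : Submodule K V // finrank K A = k} :=
      fun s => ⟨Submodule.span K (Set.range s.1), by
        rw [finrank_span_eq_card s.2]; simp⟩
    have hfib : ∀ W, Nat.card {s // f s = W} = ∏ i : Fin k, (Fintype.card K ^ k - Fintype.card K ^ (i:ℕ)) := by
      intro W
      have hW := card_linearIndependent (K := K) (V := W.1) (k := k) W.2.ge
      rw [W.2] at hW
      rw [← hW]
      refine Nat.card_congr ⟨fun s => ⟨fun i => ⟨s.1.1 i, ?_⟩, ?_⟩, fun t => ⟨⟨fun i => (t.1 i : V), ?_⟩, ?_⟩, ?_, ?_⟩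
      · have := congrArg Subtype.val s.2
        rw [← this]; exact Submodule.subset_span ⟨i, rfl⟩
      · exact LinearIndependent.of_comp W.1.subtype s.1.2
      · exact t.2.map' W.1.subtype (Submodule.ker_subtype _)
      · apply Subtype.ext
        apply Submodule.eq_of_le_of_finrank_eq
        · rw [Submodule.span_le]; rintro _ ⟨i, rfl⟩; exact (t.1 i).2
        · exact (f _).2.trans W.2.symm
      · intro s; rfl
      · intro t; rfl
    have h1 := card_linearIndependent (K := K) (V := V) h
    have : Fintype {A : Submodule K V // finrank K A = k} := Fintype.ofFinite _
    rw [Nat.card_congr (Equiv.sigmaFiberEquiv f).symm, Nat.card_sigma] at h1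
    simp only [hfib, Finset.sum_const, Finset.card_univ, smul_eq_mul] at h1
    rw [← Nat.card_eq_fintype_card] at h1
    have h2 := congrArg (Nat.cast : ℕ → ℤ) h1
    rw [Nat.cast_mul, PP_nat _ _ _ hq le_rfl, PP_nat _ _ _ hq h, ← gb_mul _ (finrank K V)] at h2
    exact_mod_cast mul_right_cancel₀ (PP_pos _ _ _ hq le_rfl).ne' h2

lemma card_below (C : Submodule K V) (k : ℕ) :
    Nat.card {A : Submodule K V // finrank K A = k ∧ A ≤ C} =
      gbinom (Fintype.card K) (finrank K C) k := by
  rw [← card_sub (V := C)]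
  refine Nat.card_congr ⟨fun A => ⟨Submodule.comap C.subtype A.1, ?_⟩,
    fun B => ⟨Submodule.map C.subtype B.1, ?_, ?_⟩, ?_, ?_⟩
  · exact (Submodule.comapSubtypeEquivOfLe A.2.2).finrank_eq.trans A.2.1
  · exact (Submodule.finrank_map_subtype_eq _ _).trans B.2
  · exact Submodule.map_subtype_le _ _
  · intro A; apply Subtype.ext; simp [Submodule.map_comap_subtype, A.2.2]
  · intro B; apply Subtype.ext
    exact Submodule.comap_map_eq_of_injective C.injective_subtype _

lemma finrank_comap_mkQ (U : Submodule K V) (B : Submodule K (V ⧸ U)) :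
    finrank K (Submodule.comap U.mkQ B) = finrank K B + finrank K U := by
  have h := LinearMap.finrank_range_add_finrank_ker (U.mkQ.domRestrict (Submodule.comap U.mkQ B))
  rw [← h]
  congr 1
  · rw [LinearMap.range_domRestrict, Submodule.map_comap_eq_self]; simp
  · rw [LinearMap.ker_domRestrict, Submodule.ker_mkQ]
    exact ((Submodule.comapSubtypeEquivOfLe (Submodule.le_comap_mkQ U B)).finrank_eq)

lemma card_above (U : Submodule K V) :
    Nat.card {A : Submodule K V // finrank K A = finrank K U + 1 ∧ U ≤ A} =
      gbinom (Fintype.card K) (finrank K V - finrank K U) 1 := by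
  have : finrank K (V ⧸ U) = finrank K V - finrank K U := by
    have := U.finrank_quotient_add_finrank; omega
  rw [← this, ← card_sub (V := V ⧸ U)]
  refine Nat.card_congr (Equiv.symm ⟨fun B => ⟨Submodule.comap U.mkQ B.1, ?_, ?_⟩, 
    fun A => ⟨Submodule.map U.mkQ A.1, ?_⟩, ?_, ?_⟩)
  · rw [finrank_comap_mkQ, B.2, add_comm]
  · exact Submodule.le_comap_mkQ U _
  · have := finrank_comap_mkQ U (Submodule.map U.mkQ A.1)
    rw [Submodule.comap_map_mkQ, sup_eq_right.2 A.2.2, A.2.1] at this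
    omega
  · intro B; apply Subtype.ext; exact Submodule.map_comap_eq_self (by simp)
  · intro A; apply Subtype.ext; simpa [Submodule.comap_map_mkQ] using A.2.2

lemma card_compl (Y : Submodule K V) :
    Fintype.card K ^ (finrank K Y * (finrank K V - finrank K Y)) ≤ Nat.card {A : Submodule K V // IsCompl Y A} := by
  have hfin : Finite V := Module.finite_of_finite K
  have hfin' : Finite (V →ₗ[K] Y) := Module.finite_of_finite K
  have hfin2 : Finite (V ⧸ Y →ₗ[K] Y) := Module.finite_of_finite K
  have : Fintype (V ⧸ Y →ₗ[K] Y) := Fintype.ofFinite _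
  have h1 : finrank K (V ⧸ Y) = finrank K V - finrank K Y := by
    have := Y.finrank_quotient_add_finrank; omega
  have h2 := Module.card_eq_pow_finrank (K := K) (V := V ⧸ Y →ₗ[K] Y)
  rw [Module.finrank_linearMap, h1, mul_comm] at h2
  rw [← h2, ← Nat.card_eq_fintype_card, Nat.card_congr Y.isComplEquivProj]
  obtain ⟨Q, hQ⟩ := Y.exists_isCompl
  let f0 := Y.isComplEquivProj ⟨Q, hQ⟩
  refine Nat.card_le_card_of_injective (fun g => ⟨f0.1 + g ∘ₗ Y.mkQ, ?_⟩) ?_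
  · intro x
    have : g (Submodule.Quotient.mk (x : V)) = 0 := by
      rw [(Submodule.Quotient.mk_eq_zero Y).2 x.2, map_zero]
    simp [f0.2 x, this]
  · intro g g' h
    have h' := congrArg Subtype.val h
    simp only [add_right_inj] at h'
    exact (LinearMap.cancel_right Y.mkQ_surjective).1 h'

lemma exists_between_rank (A B : Submodule K V) (hAB : A ≤ B) (m : ℕ) (h1 : finrank K A ≤ m)
    (h2 : m ≤ finrank K B) : ∃ C, A ≤ C ∧ C ≤ B ∧ finrank K C = m := by
  induction m, h1 using Nat.le_induction with
  | base => exact ⟨A, le_rfl, hAB, rfl⟩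
  | succ m hm ih =>
    obtain ⟨C, hC1, hC2, hC3⟩ := ih (by omega)
    have hlt : C < B := lt_of_le_of_ne hC2 (by rintro rfl; omega)
    obtain ⟨v, hvB, hvC⟩ := SetLike.exists_of_lt hlt
    refine ⟨C ⊔ K ∙ v, hC1.trans le_sup_left, sup_le hC2 (by simpa using hvB), ?_⟩
    rw [Submodule.finrank_sup_span_singleton hvC, hC3]

end Counting
section Shadow

open scoped Classical

variable {K : Type*} [Field K] [Fintype K] {V : Type*} [AddCommGroup V] [Module K V]
  [FiniteDimensional K V] [Fintype (Submodule K V)] [Fintype V]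

/-- indicator function of containing `T`, on the family `X` -/
noncomputable def phi (X : Finset (Submodule K V)) (T : Submodule K V) : X → ℚ :=
  fun A => if T ≤ A.1 then 1 else 0

/-- span of indicator functions of `T` with dimension at most `i` -/
noncomputable def MM (X : Finset (Submodule K V)) (i : ℕ) : Submodule ℚ (X → ℚ) :=
  Submodule.span ℚ {f | ∃ T : Submodule K V, finrank K T ≤ i ∧ phi X T = f}

/-- span of indicator functions of `T` with dimension exactly `i` -/
noncomputable def ME (X : Finset (Submodule K V)) (i : ℕ) : Submodule ℚ (X → ℚ) :=
  Submodule.span ℚ {f | ∃ T : Submodule K V, finrank K T = i ∧ phi X T = f}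

lemma card_submod (A : Submodule K V) :
    (Finset.univ.filter (fun v : V => v ∈ A)).card = Fintype.card K ^ finrank K A := by
  rw [← Module.card_eq_pow_finrank (K := K) (V := A), ← Fintype.card_subtype]

lemma ME_step (X : Finset (Submodule K V)) (k i : ℕ) (hX : ∀ A ∈ X, finrank K A = k)
    (hik : i < k) : ME X i ≤ ME X (i + 1) := by
  have hq : 2 ≤ Fintype.card K := Fintype.one_lt_card
  refine Submodule.span_le.2 ?_
  rintro _ ⟨S, hS, rfl⟩
  have hlt : Fintype.card K ^ i < Fintype.card K ^ k := Nat.pow_lt_pow_right (by omega) hik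
  have hlt' : ((Fintype.card K : ℚ) ^ k - (Fintype.card K : ℚ) ^ i) ≠ 0 := by
    have : (Fintype.card K : ℚ) ^ i < (Fintype.card K : ℚ) ^ k := by exact_mod_cast hlt
    exact (sub_pos.2 this).ne'
  have key : phi X S = ((Fintype.card K : ℚ) ^ k - (Fintype.card K : ℚ) ^ i)⁻¹ •
      ∑ v ∈ Finset.univ.filter (fun v : V => v ∉ S), phi X (S ⊔ K ∙ v) := by
    ext A
    simp only [Pi.smul_apply, Finset.sum_apply, phi, smul_eq_mul, sup_le_iff,
      Submodule.span_singleton_le_iff_mem]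
    by_cases h : S ≤ A.1
    · simp only [h, if_true, true_and]
      rw [Finset.sum_boole, Finset.filter_filter]
      have h1 : (Finset.univ.filter (fun v : V => v ∉ S ∧ v ∈ A.1)) =
        (Finset.univ.filter (fun v : V => v ∈ A.1)) \ (Finset.univ.filter (fun v : V => v ∈ S)) := by
        ext v; simp [and_comm]
      rw [h1, Finset.card_sdiff_of_subset, card_submod, card_submod, hX A.1 A.2, hS,
        Nat.cast_sub hlt.le]
      · push_cast
        rw [inv_mul_cancel₀ hlt']
      · intro v; simpa using fun hv => h hv
    · simp [h]
  rw [key]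
  refine Submodule.smul_mem _ _ (Submodule.sum_mem _ fun v hv => Submodule.subset_span
    ⟨S ⊔ K ∙ v, ?_, rfl⟩)
  rw [Submodule.finrank_sup_span_singleton (by simpa using hv), hS]

lemma ME_mono (X : Finset (Submodule K V)) (k i m : ℕ) (hX : ∀ A ∈ X, finrank K A = k)
    (him : i ≤ m) (hmk : m ≤ k) : ME X i ≤ ME X m := by
  induction m, him using Nat.le_induction with
  | base => exact le_rfl
  | succ m hm ih => exact (ih (by omega)).trans (ME_step X k m hX (by omega))

lemma MM_le (X : Finset (Submodule K V)) (k i m : ℕ) (hX : ∀ A ∈ X, finrank K A = k)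
    (him : i ≤ m) (hmk : m ≤ k) : MM X i ≤ ME X m := by
  refine Submodule.span_le.2 ?_
  rintro _ ⟨S, hS, rfl⟩
  exact ME_mono X k _ m hX (hS.trans him) hmk (Submodule.subset_span ⟨S, rfl, rfl⟩)

lemma phi_mul (X : Finset (Submodule K V)) (S T : Submodule K V) :
    phi X S * phi X T = phi X (S ⊔ T) := by
  ext A
  by_cases h : S ≤ A.1 <;> by_cases h' : T ≤ A.1 <;> simp [phi, h, h']

lemma MM_mul (X : Finset (Submodule K V)) (i : ℕ) (f : X → ℚ) (hf : f ∈ MM X i)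
    (B : Submodule K V) (c : ℚ) :
    f * (fun A : X => (Fintype.card K : ℚ) ^ finrank K ↥(A.1 ⊓ B) - c) ∈ MM X (i + 1) := by
  have key : (fun A : X => (Fintype.card K : ℚ) ^ finrank K ↥(A.1 ⊓ B) - c) =
      ∑ v ∈ Finset.univ.filter (fun v : V => v ∈ B), phi X (K ∙ v) - c • phi X ⊥ := by
    ext A
    simp only [Pi.sub_apply, Pi.smul_apply, Finset.sum_apply, phi, smul_eq_mul,
      Submodule.span_singleton_le_iff_mem, bot_le, if_true, mul_one, sub_left_inj]
    rw [Finset.sum_boole, Finset.filter_filter]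
    have := card_submod (K := K) (A.1 ⊓ B)
    rw [← Nat.cast_pow, ← this]
    congr 2
    ext v; simp [and_comm]
  rw [key]
  induction hf using Submodule.span_induction with
  | mem x h =>
    obtain ⟨T, hT, rfl⟩ := h
    rw [mul_sub, Finset.mul_sum, mul_smul_comm]
    refine Submodule.sub_mem _ (Submodule.sum_mem _ fun v _ => ?_) (Submodule.smul_mem _ _ ?_)
    · rw [phi_mul]
      refine Submodule.subset_span ⟨_, ?_, rfl⟩
      have h1 := Submodule.finrank_add_le_finrank_add_finrank T (K ∙ v)
      have h2 := finrank_span_le_card (R := K) ({v} : Set V)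
      simp at h2
      exact h1.trans (by omega)
    · rw [phi_mul]
      refine Submodule.subset_span ⟨_, ?_, rfl⟩
      rw [sup_bot_eq]; omega
  | zero => rw [zero_mul]; exact Submodule.zero_mem _
  | add x y _ _ hx hy => rw [add_mul]; exact Submodule.add_mem _ hx hy
  | smul a x _ hx => rw [smul_mul_assoc]; exact Submodule.smul_mem _ _ hx

lemma psi_mem (X : Finset (Submodule K V)) (k : ℕ) (B : Submodule K V) (j : ℕ) :
    (fun A : X => ∏ i ∈ Finset.range j,
      ((Fintype.card K : ℚ) ^ finrank K ↥(A.1 ⊓ B) - (Fintype.card K : ℚ) ^ (k - 1 - i))) ∈ MM X j := by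
  induction j with
  | zero =>
    refine Submodule.subset_span ⟨⊥, by simp, ?_⟩
    ext A; simp [phi]
  | succ j ih =>
    have := MM_mul X j _ ih B ((Fintype.card K : ℚ) ^ (k - 1 - j))
    convert this using 1
    ext A
    simp [Finset.prod_range_succ]

lemma shadow_card (X : Finset (Submodule K V)) (k d m : ℕ) (hX : ∀ A ∈ X, finrank K A = k)
    (hU : ∀ A ∈ X, ∀ B ∈ X, finrank K ↥(A ⊔ B) ≤ 2 * d) (h1 : 2 * d - k ≤ m) (h2 : m ≤ k) :
    X.card ≤ (Finset.univ.filter (fun T : Submodule K V => finrank K T = m ∧ ∃ A ∈ X, T ≤ A)).card := by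
  have hq : 2 ≤ Fintype.card K := Fintype.one_lt_card
  set Sh := Finset.univ.filter (fun T : Submodule K V => finrank K T = m ∧ ∃ A ∈ X, T ≤ A) with hSh
  have hle : ME X m ≤ Submodule.span ℚ ((Sh.image (phi X) : Finset (X → ℚ)) : Set (X → ℚ)) := by
    refine Submodule.span_le.2 ?_
    rintro _ ⟨T, hT, rfl⟩
    by_cases h : ∃ A ∈ X, T ≤ A
    · refine Submodule.subset_span ?_
      simp only [Finset.coe_image]
      exact ⟨T, by simp [hSh, hT, h], rfl⟩
    · have : phi X T = 0 := by
        ext A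
        push Not at h
        simp [phi, h A.1 A.2]
      rw [this]; exact Submodule.zero_mem _
  have htop : (⊤ : Submodule ℚ (X → ℚ)) ≤ ME X m := by
    have hs : ∀ B : X, (Pi.single B 1 : X → ℚ) ∈ ME X m := by
      intro B
      have hmem := MM_le X k _ m hX h1 h2 (psi_mem X k B.1 (2 * d - k))
      set c : ℚ := ∏ i ∈ Finset.range (2 * d - k),
        ((Fintype.card K : ℚ) ^ k - (Fintype.card K : ℚ) ^ (k - 1 - i)) with hc
      have hc0 : c ≠ 0 := by
        rw [hc, Finset.prod_ne_zero_iff]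
        intro i hi
        rw [Finset.mem_range] at hi
        have : Fintype.card K ^ (k - 1 - i) < Fintype.card K ^ k :=
          Nat.pow_lt_pow_right (by omega) (by omega)
        have : (Fintype.card K : ℚ) ^ (k-1-i) < (Fintype.card K : ℚ) ^ k := by exact_mod_cast this
        exact (sub_pos.2 this).ne'
      have : (Pi.single B 1 : X → ℚ) = c⁻¹ • (fun A : X => ∏ i ∈ Finset.range (2 * d - k),
          ((Fintype.card K : ℚ) ^ finrank K ↥(A.1 ⊓ B.1) - (Fintype.card K : ℚ) ^ (k - 1 - i))) := by
        ext A
        by_cases hAB : A = B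
        · subst hAB
          simp only [Pi.single_eq_same, Pi.smul_apply, smul_eq_mul]
          have e : finrank K ↥(A.1 ⊓ A.1) = k := by rw [inf_idem]; exact hX A.1 A.2
          rw [e, ← hc, inv_mul_cancel₀ hc0]
        · rw [Pi.single_eq_of_ne hAB]
          have hdim := Submodule.finrank_sup_add_finrank_inf_eq A.1 B.1
          have hAk := hX A.1 A.2
          have hBk := hX B.1 B.2
          have hu := hU A.1 A.2 B.1 B.2
          have hlt : finrank K ↥(A.1 ⊓ B.1) < k := by
            by_contra hcon
            push Not at hcon
            have e1 : A.1 ⊓ B.1 = A.1 := Submodule.eq_of_le_of_finrank_le inf_le_left (by omega)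
            have e2 : A.1 ⊓ B.1 = B.1 := Submodule.eq_of_le_of_finrank_le inf_le_right (by omega)
            exact hAB (Subtype.ext (e1.symm.trans e2))
          simp only [Pi.smul_apply, smul_eq_mul]
          rw [Finset.prod_eq_zero (i := k - 1 - finrank K ↥(A.1 ⊓ B.1)), mul_zero]
          · rw [Finset.mem_range]; omega
          · rw [sub_eq_zero]; congr 1; omega
      rw [this]
      exact Submodule.smul_mem _ _ hmem
    intro f _
    rw [pi_eq_sum_univ' f]
    refine Submodule.sum_mem _ fun B _ => Submodule.smul_mem _ _ ?_
    convert hs B using 1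
  have htop' := top_le_iff.1 (htop.trans hle)
  have hf := finrank_span_finset_le_card (R := ℚ) (Sh.image (phi X))
  rw [Set.finrank, htop', finrank_top, Module.finrank_fintype_fun_eq_card, Fintype.card_coe] at hf
  exact hf.trans Finset.card_image_le

lemma up_lemma (d : ℕ) (m : ℕ) (U : Finset (Submodule K V))
    (hdim : ∀ A ∈ U, d ≤ finrank K A ∧ finrank K A ≤ d + m)
    (hanti : ∀ A ∈ U, ∀ B ∈ U, A ≠ B → ¬ A ≤ B)
    (hU : ∀ A ∈ U, ∀ B ∈ U, finrank K ↥(A ⊔ B) ≤ 2 * d) :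
    U.card ≤ (Finset.univ.filter (fun T : Submodule K V => finrank K T = d ∧ ∃ A ∈ U, T ≤ A)).card := by
  induction m generalizing U with
  | zero =>
    apply Finset.card_le_card
    intro A hA
    have := hdim A hA
    simp only [Finset.mem_filter, Finset.mem_univ, true_and]
    exact ⟨by omega, A, hA, le_rfl⟩
  | succ m ih =>
    set X := U.filter (fun A : Submodule K V => finrank K A = d + m + 1) with hXdef
    set S := Finset.univ.filter (fun T : Submodule K V => finrank K T = d + m ∧ ∃ A ∈ X, T ≤ A) with hS
    set Y := U.filter (fun A : Submodule K V => ¬ finrank K A = d + m + 1) with hYdef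
    have hX : ∀ A : Submodule K V, A ∈ X → A ∈ U ∧ finrank K A = d + m + 1 := fun A hA => by simpa [hXdef] using hA
    have hY : ∀ A ∈ Y, A ∈ U ∧ finrank K A ≤ d + m := fun A hA => by
      have hA' : A ∈ U ∧ ¬ finrank K A = d + m + 1 := by simpa [hYdef] using hA
      have := hdim A hA'.1
      exact ⟨hA'.1, by omega⟩
    have hS' : ∀ A ∈ S, finrank K A = d + m ∧ ∃ B ∈ X, A ≤ B := fun A hA => by simpa [hS] using hA
    have hXS : X.card ≤ S.card :=
      shadow_card X (d + m + 1) d (d + m) (fun A hA => (hX A hA).2)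
        (fun A hA B hB => hU A (hX A hA).1 B (hX B hB).1) (by omega) (by omega)
    have hcard : X.card + Y.card = U.card := Finset.card_filter_add_card_filter_not _
    have hYX : ∀ A ∈ Y, ∀ B ∈ X, ¬ A ≤ B := fun A hA B hB => by
      refine hanti A (hY A hA).1 B (hX B hB).1 ?_
      rintro rfl
      have := (hY A hA).2; have := (hX A hB).2; omega
    have hdisj : Disjoint S Y := by
      rw [Finset.disjoint_left]
      intro A hA hA'
      obtain ⟨_, B, hB, hAB⟩ := hS' A hA
      exact hYX A hA' B hB hAB
    have hle : ∀ A ∈ S ∪ Y, ∃ B ∈ U, A ≤ B := by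
      intro A hA
      rcases Finset.mem_union.1 hA with h | h
      · obtain ⟨_, B, hB, hAB⟩ := hS' A h
        exact ⟨B, (hX B hB).1, hAB⟩
      · exact ⟨A, (hY A h).1, le_rfl⟩
    have := ih (S ∪ Y) ?_ ?_ ?_
    · rw [Finset.card_union_of_disjoint hdisj] at this
      calc U.card ≤ S.card + Y.card := by omega
        _ ≤ _ := this
        _ ≤ _ := by
          apply Finset.card_le_card
          intro T hT
          simp only [Finset.mem_filter, Finset.mem_univ, true_and] at hT ⊢
          obtain ⟨h1, A, hA, h2⟩ := hT
          obtain ⟨B, hB, hAB⟩ := hle A hA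
          exact ⟨h1, B, hB, h2.trans hAB⟩
    · intro A hA
      rcases Finset.mem_union.1 hA with h | h
      · have := (hS' A h).1; omega
      · have := hY A h; have := hdim A this.1; omega
    · intro A hA B hB hne hAB
      rcases Finset.mem_union.1 hB with h' | h'
      · obtain ⟨hBd, C, hC, hBC⟩ := hS' B h'
        rcases Finset.mem_union.1 hA with h | h
        · exact hne (Submodule.eq_of_le_of_finrank_eq hAB ((hS' A h).1.trans hBd.symm))
        · exact hYX A h C hC (hAB.trans hBC)
      · rcases Finset.mem_union.1 hA with h | h
        · have h3 := (hS' A h).1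
          have h4 := (hY B h').2
          exact hne (Submodule.eq_of_le_of_finrank_le hAB (by omega))
        · exact hanti A (hY A h).1 B (hY B h').1 hne hAB
    · intro A hA B hB
      obtain ⟨A', hA', hAA⟩ := hle A hA
      obtain ⟨B', hB', hBB⟩ := hle B hB
      exact (Submodule.finrank_mono (sup_le_sup hAA hBB)).trans (hU A' hA' B' hB')

end Shadow
section Lower

open scoped Classical

variable {K : Type*} [Field K] [Fintype K] {V : Type*} [AddCommGroup V] [Module K V]
  [FiniteDimensional K V] [Fintype (Submodule K V)]

/-- upper shadow at level `i` -/
noncomputable def upS (i : ℕ) (G : Finset (Submodule K V)) : Finset (Submodule K V) :=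
  Finset.univ.filter (fun C : Submodule K V => finrank K C = i ∧ ∃ A ∈ G, A ≤ C)

lemma mem_upS {i : ℕ} {G : Finset (Submodule K V)} {C : Submodule K V} :
    C ∈ upS i G ↔ finrank K C = i ∧ ∃ A ∈ G, A ≤ C := by simp [upS]

lemma card_upS_singleton (A : Submodule K V) (i : ℕ) (hA : finrank K A = i) :
    (upS (i + 1) {A}).card = gbinom (Fintype.card K) (finrank K V - i) 1 := by
  subst hA
  rw [← card_above A, Nat.card_eq_fintype_card, Fintype.card_subtype]
  congr 1
  ext C; simp [mem_upS]

lemma gain (d i : ℕ) (hn : 2 * d < finrank K V) (hi : i < d) (G : Finset (Submodule K V))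
    (hG : ∀ A ∈ G, finrank K A = i) (hne : G.Nonempty) :
    G.card + gbinom (Fintype.card K) (finrank K V - i) 1 ≤ (upS (i + 1) G).card + 1 ∧
    (G.card + gbinom (Fintype.card K) (finrank K V - i) 1 = (upS (i + 1) G).card + 1 →
      G.card = 1) := by
  have hq : 2 ≤ Fintype.card K := Fintype.one_lt_card
  obtain ⟨A, hA⟩ := hne
  set q := Fintype.card K with hqdef
  set r := gbinom q (finrank K V - i) 1 with hr
  have hsub : upS (i+1) {A} ⊆ upS (i+1) G := by
    intro C hC
    rw [mem_upS] at hC ⊢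
    obtain ⟨h1, B, hB, h2⟩ := hC
    rw [Finset.mem_singleton] at hB
    exact ⟨h1, A, hA, hB ▸ h2⟩
  set T := upS (i+1) G \ upS (i+1) {A} with hT
  have hcT : T.card + r = (upS (i+1) G).card := by
    rw [hr, ← card_upS_singleton A i (hG A hA)]
    exact Finset.card_sdiff_add_card_eq_card hsub
  have hcG : (G.erase A).card + 1 = G.card := Finset.card_erase_add_one hA
  have hrbig : q ^ (i + 2) ≤ r := by
    have h := gb_one_ge q (finrank K V - i - 1)
    rw [show finrank K V - i - 1 + 1 = finrank K V - i by omega] at h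
    exact (Nat.pow_le_pow_right (by omega) (by omega)).trans h
  have hc := gb_co_lt q i hq
  have hpow : q ^ (i+2) = q ^ (i+1) * q := pow_succ q (i+1)
  have hpos : 0 < q ^ (i+1) := Nat.pow_pos (by omega)
  have hdc : (G.erase A).card * (r - 1) ≤ T.card * gbinom q (i+1) i := by
    apply Finset.card_mul_le_card_mul (fun B C : Submodule K V => B ≤ C)
    · intro B hB
      have hBG := Finset.mem_of_mem_erase hB
      have hBA := Finset.ne_of_mem_erase hB
      rw [hr, ← card_upS_singleton B i (hG B hBG)]
      have : upS (i+1) {B} ⊆ insert (A ⊔ B) (T.bipartiteAbove (fun B C : Submodule K V => B ≤ C) B) := by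
        intro C hC
        rw [mem_upS] at hC
        obtain ⟨h1, B', hB', h2⟩ := hC
        rw [Finset.mem_singleton] at hB'
        subst hB'
        rw [Finset.mem_insert]
        by_cases hAC : A ≤ C
        · left
          symm
          apply Submodule.eq_of_le_of_finrank_le (sup_le hAC h2)
          rw [h1]
          by_contra hcon
          push Not at hcon
          have e1 : B' = A ⊔ B' := Submodule.eq_of_le_of_finrank_le le_sup_right (by
            rw [hG B' hBG]; omega)
          have e2 : A = A ⊔ B' := Submodule.eq_of_le_of_finrank_le le_sup_left (by
            rw [hG A hA]; omega)
          exact hBA (e1.trans e2.symm)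
        · right
          rw [Finset.mem_bipartiteAbove, hT, Finset.mem_sdiff, mem_upS, mem_upS]
          refine ⟨⟨⟨h1, B', hBG, h2⟩, ?_⟩, h2⟩
          rintro ⟨_, A', hA', h3⟩
          rw [Finset.mem_singleton] at hA'
          exact hAC (hA' ▸ h3)
      have h3 := (Finset.card_le_card this).trans (Finset.card_insert_le _ _)
      omega
    · intro C hC
      rw [hT, Finset.mem_sdiff, mem_upS] at hC
      have h1 : finrank K C = i + 1 := hC.1.1
      rw [← h1, hqdef, ← card_below C i, Nat.card_eq_fintype_card, Fintype.card_subtype]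
      apply Finset.card_le_card
      intro B hB
      rw [Finset.mem_bipartiteBelow] at hB
      simp only [Finset.mem_filter, Finset.mem_univ, true_and]
      exact ⟨hG B (Finset.mem_of_mem_erase hB.1), hB.2⟩
  have hrc : gbinom q (i+1) i + 1 ≤ r - 1 := by
    have : q ^ (i+1) * 2 ≤ q^(i+1) * q := Nat.mul_le_mul_left _ hq
    omega
  have hfin : (G.erase A).card ≤ T.card ∧ ((G.erase A).card = T.card → (G.erase A).card = 0) := by
    set g := (G.erase A).card
    set t := T.card
    set c := gbinom q (i+1) i
    have h5 : g * (c + 1) ≤ t * c := (Nat.mul_le_mul_left _ hrc).trans hdc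
    constructor
    · by_contra hcon
      push Not at hcon
      nlinarith
    · intro h; rw [h] at h5 ⊢; nlinarith
  constructor
  · omega
  · intro h
    have := hfin.2 (by omega)
    omega

lemma low_lemma (d e : ℕ) (hn : 2 * d < finrank K V) (he : e < d) (m : ℕ) (L : Finset (Submodule K V))
    (hdim : ∀ A ∈ L, e ≤ finrank K A + m ∧ finrank K A ≤ e)
    (hanti : ∀ A ∈ L, ∀ B ∈ L, A ≠ B → ¬ A ≤ B) :
    L.card ≤ (upS e L).card ∧ (L.card = (upS e L).card → ∀ A ∈ L, finrank K A = e) := by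
  have hq : 2 ≤ Fintype.card K := Fintype.one_lt_card
  induction m generalizing L with
  | zero =>
    refine ⟨Finset.card_le_card ?_, ?_⟩
    · intro A hA
      have := hdim A hA
      rw [mem_upS]
      exact ⟨by omega, A, hA, le_rfl⟩
    · intro _ A hA
      have := hdim A hA
      omega
  | succ m ih =>
    by_cases hex : ∀ A ∈ L, e ≤ finrank K A + m
    · exact ih L (fun A hA => ⟨hex A hA, (hdim A hA).2⟩) hanti
    push Not at hex
    obtain ⟨A0, hA0, hA0d⟩ := hex
    obtain ⟨i, hi⟩ : ∃ i, i + m + 1 = e := ⟨finrank K A0, by have := hdim A0 hA0; omega⟩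
    have hA0i : finrank K A0 = i := by have := hdim A0 hA0; omega
    set X := L.filter (fun A : Submodule K V => finrank K A = i) with hXdef
    set Y := L.filter (fun A : Submodule K V => ¬ finrank K A = i) with hYdef
    set S := upS (i+1) X with hS
    have hX : ∀ A : Submodule K V, A ∈ X → A ∈ L ∧ finrank K A = i := fun A hA => by simpa [hXdef] using hA
    have hY : ∀ A : Submodule K V, A ∈ Y → A ∈ L ∧ i + 1 ≤ finrank K A := fun A hA => by
      have hA' : A ∈ L ∧ ¬ finrank K A = i := by simpa [hYdef] using hA
      have := hdim A hA'.1
      exact ⟨hA'.1, by omega⟩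
    have hS' : ∀ A : Submodule K V, A ∈ S → finrank K A = i + 1 ∧ ∃ B ∈ X, B ≤ A := fun A hA => mem_upS.1 hA
    have hXS : X.card < S.card := by
      have h1 := (gain d i hn (by omega) X (fun A hA => (hX A hA).2)
        ⟨A0, by simp [hXdef, hA0, hA0i]⟩).1
      have h := gb_one_ge (Fintype.card K) (finrank K V - i - 1)
      rw [show finrank K V - i - 1 + 1 = finrank K V - i by omega] at h
      have h3 : 2 ≤ Fintype.card K ^ (finrank K V - i - 1) :=
        hq.trans (Nat.le_self_pow (by omega) _)
      rw [← hS] at h1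
      omega
    have hcard : X.card + Y.card = L.card := Finset.card_filter_add_card_filter_not _
    have hYX : ∀ A ∈ Y, ∀ B ∈ X, ¬ B ≤ A := fun A hA B hB => by
      refine hanti B (hX B hB).1 A (hY A hA).1 ?_
      rintro rfl
      have := (hY B hA).2; have := (hX B hB).2; omega
    have hdisj : Disjoint S Y := by
      rw [Finset.disjoint_left]
      intro A hA hA'
      obtain ⟨_, B, hB, hAB⟩ := hS' A hA
      exact hYX A hA' B hB hAB
    have hle : ∀ A ∈ S ∪ Y, ∃ B ∈ L, B ≤ A := by
      intro A hA
      rcases Finset.mem_union.1 hA with h | h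
      · obtain ⟨_, B, hB, hAB⟩ := hS' A h
        exact ⟨B, (hX B hB).1, hAB⟩
      · exact ⟨A, (hY A h).1, le_rfl⟩
    have := (ih (S ∪ Y) ?_ ?_).1
    · rw [Finset.card_union_of_disjoint hdisj] at this
      have h2 : (upS e (S ∪ Y)).card ≤ (upS e L).card := by
        apply Finset.card_le_card
        intro T hT
        rw [mem_upS] at hT ⊢
        obtain ⟨h1, A, hA, h2⟩ := hT
        obtain ⟨B, hB, hAB⟩ := hle A hA
        exact ⟨h1, B, hB, hAB.trans h2⟩
      exact ⟨by omega, fun h => by omega⟩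
    · intro A hA
      rcases Finset.mem_union.1 hA with h | h
      · have := (hS' A h).1; omega
      · have := hY A h; have := hdim A this.1; omega
    · intro A hA B hB hne hAB
      rcases Finset.mem_union.1 hA with h' | h'
      · obtain ⟨hAd, C, hC, hCA⟩ := hS' A h'
        rcases Finset.mem_union.1 hB with h | h
        · exact hne (Submodule.eq_of_le_of_finrank_eq hAB (hAd.trans (hS' B h).1.symm))
        · exact hYX B h C hC (hCA.trans hAB)
      · rcases Finset.mem_union.1 hB with h | h
        · have h3 := (hS' B h).1
          have h4 := (hY A h').2
          exact hne (Submodule.eq_of_le_of_finrank_le hAB (by omega))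
        · exact hanti A (hY A h').1 B (hY B h).1 hne hAB

/-- gain for an antichain below level `d` -/
lemma low_gain (d : ℕ) (hn : 2 * d < finrank K V) (hd : 1 ≤ d) (L : Finset (Submodule K V))
    (hdim : ∀ A ∈ L, finrank K A < d) (hne : L.Nonempty)
    (hanti : ∀ A ∈ L, ∀ B ∈ L, A ≠ B → ¬ A ≤ B) :
    L.card + gbinom (Fintype.card K) (finrank K V - (d - 1)) 1 ≤ (upS d L).card + 1 ∧
    (L.card + gbinom (Fintype.card K) (finrank K V - (d - 1)) 1 = (upS d L).card + 1 →
      ∃ U, L = {U} ∧ finrank K U = d - 1) := by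
  have h1 := low_lemma d (d-1) hn (by omega) (d-1) L
    (fun A hA => by have := hdim A hA; omega) hanti
  have hGne : (upS (d-1) L).Nonempty := by
    rw [← Finset.card_pos]; have := Finset.card_pos.2 hne; omega
  have h2 := gain d (d-1) hn (by omega) (upS (d-1) L) (fun A hA => (mem_upS.1 hA).1) hGne
  rw [show d - 1 + 1 = d by omega] at h2
  have h3 : (upS d (upS (d-1) L)).card ≤ (upS d L).card := by
    apply Finset.card_le_card
    intro T hT
    rw [mem_upS] at hT ⊢
    obtain ⟨h1, A, hA, h2⟩ := hT
    obtain ⟨_, B, hB, hAB⟩ := mem_upS.1 hA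
    exact ⟨h1, B, hB, hAB.trans h2⟩
  refine ⟨by omega, fun h => ?_⟩
  have h4 := h2.2 (by omega)
  have h5 := h1.2 (by omega)
  obtain ⟨U, hU⟩ := Finset.card_eq_one.1 (show L.card = 1 by omega)
  exact ⟨U, hU, h5 U (by simp [hU])⟩

/-- many `d`-spaces in general position to `W` -/
lemma big_N (d : ℕ) (hd : 2 ≤ d) (hn : 2 * d < finrank K V) (W : Submodule K V)
    (hW : d < finrank K W) :
    gbinom (Fintype.card K) (finrank K V - (d - 1)) 1 <
      (Finset.univ.filter (fun D : Submodule K V => finrank K D = d ∧ 2 * d < finrank K ↥(D ⊔ W))).card := by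
  have hq : 2 ≤ Fintype.card K := Fintype.one_lt_card
  obtain ⟨W', -, hW', hW'd⟩ := exists_between_rank ⊥ W bot_le (d+1) (by simp) hW
  obtain ⟨Y, hY, -, hYd⟩ := exists_between_rank W' ⊤ le_top (finrank K V - d) (by omega)
    (by rw [finrank_top]; omega)
  have h1 := card_compl Y
  rw [Nat.card_eq_fintype_card, Fintype.card_subtype] at h1
  have h2 : (Finset.univ.filter (fun A : Submodule K V => IsCompl Y A)).card ≤
      (Finset.univ.filter (fun D : Submodule K V => finrank K D = d ∧ 2 * d < finrank K ↥(D ⊔ W))).card := by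
    apply Finset.card_le_card
    intro D hD
    simp only [Finset.mem_filter, Finset.mem_univ, true_and] at hD ⊢
    have h3 := Submodule.finrank_add_eq_of_isCompl hD
    have h4 : finrank K D = d := by omega
    refine ⟨h4, ?_⟩
    have h5 := Submodule.finrank_sup_add_finrank_inf_eq D W'
    have h6 : D ⊓ W' = ⊥ := (hD.disjoint.symm.mono_right hY).eq_bot
    rw [h6, finrank_bot] at h5
    have h7 := Submodule.finrank_mono (sup_le_sup_left hW' D)
    omega
  refine lt_of_lt_of_le (gb_one_lt _ _ hq) ((Nat.pow_le_pow_right (by omega) ?_).trans (h1.trans h2))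
  rw [hYd]
  obtain ⟨m, hm⟩ : ∃ m, finrank K V = 2 * d + 1 + m := ⟨finrank K V - (2*d+1), by omega⟩
  rw [hm, show 2*d+1+m - (2*d+1+m-d) = d by omega, show 2*d+1+m-d = d+1+m by omega,
    show 2*d+1+m-(d-1) = d+2+m by omega]
  nlinarith

end Lower

theorem stmt_17 (q n d : ℕ) (K : Type*) [Field K] [Fintype K] (hK : Fintype.card K = q)
    (V : Type*) [AddCommGroup V] [Module K V] [FiniteDimensional K V]
    (hV : finrank K V = n) (hd : 2 ≤ d) (hsn : 2 * d < n)
    (F : Set (Submodule K V))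
    (hF : ∀ A ∈ F, ∀ B ∈ F, finrank K ↥(A ⊔ B) ≤ 2 * d)
    (hanti : ∀ A ∈ F, ∀ B ∈ F, A ≠ B → ¬ A ≤ B)
    (hns : ¬ F ⊆ {A : Submodule K V | finrank K A = d}) :
    (F.ncard : ℤ) ≤ (gbinom q n d : ℤ) - (q : ℤ) * (gbinom q (n - d) 1 : ℤ)
    ∧ ((F.ncard : ℤ) = (gbinom q n d : ℤ) - (q : ℤ) * (gbinom q (n - d) 1 : ℤ)
        ↔ ∃ U : Submodule K V, finrank K U = d - 1 ∧
            F = {A : Submodule K V | finrank K A = d ∧ ¬ U ≤ A} ∪ {U}) := by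
  classical
  subst hK hV
  have hfin : Finite V := Module.finite_of_finite K
  let : Fintype V := Fintype.ofFinite V
  let : Fintype (Submodule K V) := Fintype.ofFinite _
  set q := Fintype.card K with hq
  set n := finrank K V with hn
  set r := gbinom q (n - (d - 1)) 1 with hr
  have hr1 : r = 1 + q * gbinom q (n - d) 1 := by
    rw [hr, show n - (d-1) = (n - d) + 1 by omega, gb_one_succ]
  have hr2 : (r : ℤ) = 1 + (q:ℤ) * (gbinom q (n - d) 1 : ℤ) := by rw [hr1]; push_cast; rfl
  set Lv : Finset (Submodule K V) := Finset.univ.filter (fun A : Submodule K V => finrank K A = d) with hLv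
  have hLvc : Lv.card = gbinom q n d := by
    rw [hq, hn, ← card_sub (K := K) (V := V) d, Nat.card_eq_fintype_card, Fintype.card_subtype]
  set FF : Finset (Submodule K V) := F.toFinset with hFF
  have hmemF : ∀ A, A ∈ FF ↔ A ∈ F := fun A => by simp [hFF]
  have hFc : F.ncard = FF.card := Set.ncard_eq_toFinset_card' F
  -- the family attached to U
  have hfam : ∀ U : Submodule K V, finrank K U = d - 1 →
      (Lv.filter (fun A => ¬ U ≤ A)).card + r = Lv.card := by
    intro U hU
    have h1 := card_upS_singleton U (d-1) hU
    rw [show d - 1 + 1 = d by omega] at h1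
    change (upS d {U}).card = r at h1
    have h2 : Lv.filter (fun A => U ≤ A) = upS d {U} := by
      ext A; simp [mem_upS, hLv]
    have h3 := Finset.card_filter_add_card_filter_not (s := Lv) (fun A => U ≤ A)
    rw [h2, h1] at h3
    omega
  set L := FF.filter (fun A : Submodule K V => finrank K A < d) with hL
  set M := FF.filter (fun A : Submodule K V => ¬ finrank K A < d) with hM
  have hLM : L.card + M.card = FF.card := Finset.card_filter_add_card_filter_not _
  have hLmem : ∀ A : Submodule K V, A ∈ L ↔ A ∈ F ∧ finrank K A < d := fun A => by simp [hL, hmemF]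
  have hMmem : ∀ A : Submodule K V, A ∈ M ↔ A ∈ F ∧ d ≤ finrank K A := fun A => by simp [hM, hmemF]
  set S := Finset.univ.filter (fun T : Submodule K V => finrank K T = d ∧ ∃ A ∈ M, T ≤ A) with hS
  have hMS : M.card ≤ S.card := by
    apply up_lemma d d M
    · intro A hA
      have h1 := (hMmem A).1 hA
      have h2 := hF A h1.1 A h1.1
      rw [sup_idem] at h2
      exact ⟨h1.2, by omega⟩
    · exact fun A hA B hB => hanti A ((hMmem A).1 hA).1 B ((hMmem B).1 hB).1
    · exact fun A hA B hB => hF A ((hMmem A).1 hA).1 B ((hMmem B).1 hB).1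
  have hSmem : ∀ T : Submodule K V, T ∈ S ↔ finrank K T = d ∧ ∃ A ∈ M, T ≤ A := fun T => by simp [hS]
  set T := upS d L with hT
  have hST : Disjoint S T := by
    rw [Finset.disjoint_left]
    intro D hD hD'
    obtain ⟨h1, A, hA, hDA⟩ := (hSmem D).1 hD
    obtain ⟨_, B, hB, hBD⟩ := mem_upS.1 hD'
    have hA' := (hMmem A).1 hA
    have hB' := (hLmem B).1 hB
    exact hanti B hB'.1 A hA'.1 (by rintro rfl; omega) (hBD.trans hDA)
  have hSLv : S ⊆ Lv := fun D hD => by simp [hLv, ((hSmem D).1 hD).1]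
  have hTLv : T ⊆ Lv := fun D hD => by simp [hLv, (mem_upS.1 hD).1]
  have hLanti : ∀ A ∈ L, ∀ B ∈ L, A ≠ B → ¬ A ≤ B := 
    fun A hA B hB => hanti A ((hLmem A).1 hA).1 B ((hLmem B).1 hB).1
  have hSTc : S.card + T.card ≤ Lv.card := by
    rw [← Finset.card_union_of_disjoint hST]
    exact Finset.card_le_card (Finset.union_subset hSLv hTLv)
  have hgain : L.Nonempty → L.card + r ≤ T.card + 1 ∧
      (L.card + r = T.card + 1 → ∃ U, L = {U} ∧ finrank K U = d - 1) := fun hne =>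
    low_gain d hsn (by omega) L (fun A hA => ((hLmem A).1 hA).2) hne hLanti
  -- main dichotomy
  have hmain : FF.card + r ≤ Lv.card + 1 ∧ (FF.card + r = Lv.card + 1 →
      ∃ U, L = {U} ∧ finrank K U = d - 1 ∧ ∀ A ∈ F, finrank K A ≤ d) := by
    by_cases hup : ∀ A ∈ F, finrank K A ≤ d
    · have hLne : L.Nonempty := by
        rw [Set.not_subset] at hns
        obtain ⟨A, hA, hA'⟩ := hns
        have hA' : finrank K A ≠ d := hA'
        have := hup A hA
        exact ⟨A, (hLmem A).2 ⟨hA, by omega⟩⟩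
      obtain ⟨g1, g2⟩ := hgain hLne
      refine ⟨by omega, fun h => ?_⟩
      obtain ⟨U, h1, h2⟩ := g2 (by omega)
      exact ⟨U, h1, h2, hup⟩
    · push Not at hup
      obtain ⟨W, hWF, hWd⟩ := hup
      have hN := big_N d hd hsn W hWd
      set N := Finset.univ.filter (fun D : Submodule K V => finrank K D = d ∧ 2 * d < finrank K ↥(D ⊔ W)) with hNdef
      have hNLv : N ⊆ Lv := fun D hD => by
        have : finrank K D = d ∧ 2 * d < finrank K ↥(D ⊔ W) := by simpa [hNdef] using hD
        simp [hLv, this.1]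
      have hSN : Disjoint S N := by
        rw [Finset.disjoint_left]
        intro D hD hD'
        have h1 : finrank K D = d ∧ 2 * d < finrank K ↥(D ⊔ W) := by simpa [hNdef] using hD'
        obtain ⟨_, A, hA, hDA⟩ := (hSmem D).1 hD
        have h2 := hF A ((hMmem A).1 hA).1 W hWF
        have h3 := Submodule.finrank_mono (sup_le_sup_right hDA W)
        omega
      have hSNc : S.card + N.card ≤ Lv.card := by
        rw [← Finset.card_union_of_disjoint hSN]
        exact Finset.card_le_card (Finset.union_subset hSLv hNLv)
      have hN' : r < N.card := hN
      suffices h : FF.card + r < Lv.card + 1 from ⟨h.le, fun h' => by omega⟩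
      rcases L.eq_empty_or_nonempty with h0 | hne
      · rw [h0, Finset.card_empty] at hLM
        omega
      · obtain ⟨g1, g2⟩ := hgain hne
        by_cases heq : L.card + r = T.card + 1
        · obtain ⟨U, hU, _⟩ := g2 heq
          rw [hU, Finset.card_singleton] at hLM heq
          omega
        · omega
  refine ⟨by rw [hFc]; have := hmain.1; omega, ?_⟩
  constructor
  · intro h
    have h' : FF.card + r = Lv.card + 1 := by omega
    obtain ⟨U, hU, hUd, hup⟩ := hmain.2 h'
    refine ⟨U, hUd, ?_⟩
    have hUF : U ∈ F := ((hLmem U).1 (by simp [hU])).1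
    have hMeq : M = Lv.filter (fun A => ¬ U ≤ A) := by
      apply Finset.eq_of_subset_of_card_le
      · intro A hA
        have h1 := (hMmem A).1 hA
        have h2 := hup A h1.1
        simp only [hLv, Finset.mem_filter, Finset.mem_univ, true_and]
        exact ⟨by omega, hanti U hUF A h1.1 (by rintro rfl; omega)⟩
      · have := hfam U hUd
        rw [hU, Finset.card_singleton] at hLM
        omega
    ext A
    have hA1 : A ∈ M ↔ finrank K A = d ∧ ¬ U ≤ A := by rw [hMeq]; simp [hLv]
    have hA2 : A ∈ L ↔ A = U := by rw [hU]; simp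
    rw [hMmem] at hA1
    rw [hLmem] at hA2
    simp only [Set.mem_union, Set.mem_ofPred_eq, Set.mem_singleton_iff]
    rw [← hA1, ← hA2, ← and_or_left]
    have : d ≤ finrank K A ∨ finrank K A < d := le_or_gt _ _
    exact ⟨fun h => ⟨h, this⟩, fun h => h.1⟩
  · rintro ⟨U, hUd, hFU⟩
    have h1 : FF = insert U (Lv.filter (fun A => ¬ U ≤ A)) := by
      ext A
      rw [hmemF, hFU]
      simp [hLv, or_comm]
    have h2 : U ∉ Lv.filter (fun A => ¬ U ≤ A) := by simp
    have h3 := hfam U hUd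
    rw [hFc, h1, Finset.card_insert_of_notMem h2]
    omega
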